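/- Let L = F_q with q = 2^n, let k ≥ 2, and let f(x) = x^{2^k+1} + h(x) ∈ L[x] where h has degree d with d ≡ 1 (mod 4), 5 ≤ d < 2^k+1. If φ_{2^k+1} and φ_d are relatively prime (have no nonconstant common factor over the algebraic closure of L), then φ(x,y,z) is absolutely irreducible. -/

import Mathlib

open MvPolynomial

/-- The polynomial `(x+y)(x+z)(y+z)` in `L[x,y,z]` (variables `X 0, X 1, X 2`). -/
noncomputable def delta3 (L : Type) [CommRing L] : MvPolynomial (Fin 3) L :=
  (X 0 + X 1) * (X 0 + X 2) * (X 1 + X 2)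

/-- The numerator `f(x) + f(y) + f(z) + f(x+y+z)` of `φ`, as an element of `L[x,y,z]`. -/
noncomputable def phiNum {L : Type} [CommRing L] (f : Polynomial L) :
    MvPolynomial (Fin 3) L :=
  Polynomial.aeval (X 0 : MvPolynomial (Fin 3) L) f +
    Polynomial.aeval (X 1 : MvPolynomial (Fin 3) L) f +
    Polynomial.aeval (X 2 : MvPolynomial (Fin 3) L) f +
    Polynomial.aeval (X 0 + X 1 + X 2 : MvPolynomial (Fin 3) L) f

/-- The numerator `x^j + y^j + z^j + (x+y+z)^j` of `φ_j`, as an element of `L[x,y,z]`. -/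
noncomputable def phiJNum (L : Type) [CommRing L] (j : ℕ) : MvPolynomial (Fin 3) L :=
  X 0 ^ j + X 1 ^ j + X 2 ^ j + (X 0 + X 1 + X 2) ^ j

/-- A polynomial over a field `L` is absolutely irreducible if it is irreducible over
the algebraic closure of `L`. -/
def AbsolutelyIrreducible {L : Type} [Field L] (p : MvPolynomial (Fin 3) L) : Prop :=
  Irreducible (MvPolynomial.map (algebraMap L (AlgebraicClosure L)) p)

section Homogenization

variable {σ R : Type*} [CommRing R]

/-- The substitution `X i ↦ X i * T`, whose coefficient at `T ^ n` is the homogeneous part of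
degree `n`. -/
noncomputable def gradingHom : MvPolynomial σ R →ₐ[R] Polynomial (MvPolynomial σ R) :=
  aeval fun i => Polynomial.C (X i) * Polynomial.X

lemma gradingHom_coeff_isHomogeneous (p : MvPolynomial σ R) (n : ℕ) :
    ((gradingHom p).coeff n).IsHomogeneous n := by
  induction p using MvPolynomial.induction_on generalizing n with
  | C a =>
    rw [← algebraMap_eq, AlgHom.commutes, Polynomial.algebraMap_apply, algebraMap_eq,
      Polynomial.coeff_C]
    split_ifs with h
    · exact h ▸ isHomogeneous_C σ a
    · exact isHomogeneous_zero σ R n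
  | add p q hp hq => simpa using (hp n).add (hq n)
  | mul_X p i hp =>
    have h : gradingHom (p * X i) = gradingHom p * Polynomial.C (X i) * Polynomial.X := by
      simp [gradingHom, mul_assoc]
    rw [h]
    cases n with
    | zero => simpa using isHomogeneous_zero σ R 0
    | succ n =>
      rw [Polynomial.coeff_mul_X, Polynomial.coeff_mul_C]
      exact (hp n).mul (isHomogeneous_X R i)

lemma eval_one_gradingHom (p : MvPolynomial σ R) : (gradingHom p).eval 1 = p := by
  induction p using MvPolynomial.induction_on with
  | C a => simp [gradingHom]
  | add p q hp hq => simp [hp, hq]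
  | mul_X p i hp => rw [map_mul, Polynomial.eval_mul, hp]; simp [gradingHom]

lemma coeff_aeval_C_mul_X {A : Type*} [CommRing A] [Algebra R A] (f : Polynomial R) (l : A)
    (n : ℕ) : (Polynomial.aeval (Polynomial.C l * Polynomial.X) f).coeff n =
      algebraMap R A (f.coeff n) * l ^ n := by
  induction f using Polynomial.induction_on' with
  | add p q hp hq => simp [hp, hq, add_mul]
  | monomial m a =>
    rw [Polynomial.aeval_monomial, Polynomial.algebraMap_apply, mul_pow, ← Polynomial.C_pow,
      ← mul_assoc, ← Polynomial.C_mul, Polynomial.coeff_C_mul_X_pow, Polynomial.coeff_monomial]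
    rcases eq_or_ne n m with rfl | h
    · simp
    · simp [h, h.symm]

lemma natDegree_aeval_le_totalDegree (g : σ → Polynomial R)
    (hg : ∀ i, (g i).natDegree ≤ 1) (p : MvPolynomial σ R) :
    (aeval g p).natDegree ≤ p.totalDegree := by
  rw [aeval_def, eval₂_eq]
  refine Polynomial.natDegree_sum_le_of_forall_le _ _ fun m hm => ?_
  refine (Polynomial.natDegree_C_mul_le _ _).trans ?_
  refine (Polynomial.natDegree_prod_le _ _).trans ?_
  refine le_trans (Finset.sum_le_sum fun i _ => ?_) (le_totalDegree hm)
  exact Polynomial.natDegree_pow_le.trans (by simpa using Nat.mul_le_mul_left (m i) (hg i))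

end Homogenization

/-- In a product whose constant coefficients are relatively prime and whose coefficients of index
`1, …, e - 1` vanish, the same coefficients of both factors vanish, as soon as divisibility by the
constant coefficient forces vanishing. -/
lemma Polynomial.coeff_eq_zero_of_mul_coeff_eq_zero {A : Type*} [CommRing A]
    [DecompositionMonoid A] {a b : Polynomial A} {e : ℕ}
    (hab : IsRelPrime (a.coeff 0) (b.coeff 0))
    (ha : ∀ r, 0 < r → a.coeff 0 ∣ a.coeff r → a.coeff r = 0)
    (hb : ∀ r, 0 < r → b.coeff 0 ∣ b.coeff r → b.coeff r = 0)
    (h : ∀ r, 0 < r → r < e → (a * b).coeff r = 0) :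
    (∀ r, 0 < r → r < e → a.coeff r = 0 ∧ b.coeff r = 0) ∧
      (0 < e → (a * b).coeff e = a.coeff 0 * b.coeff e + a.coeff e * b.coeff 0) := by
  have key : ∀ n, 0 < n → (∀ r, 0 < r → r < n → a.coeff r = 0 ∧ b.coeff r = 0) →
      (a * b).coeff n = a.coeff 0 * b.coeff n + a.coeff n * b.coeff 0 := by
    intro n hn hlow
    rw [Polynomial.coeff_mul, Finset.Nat.sum_antidiagonal_eq_sum_range_succ
      (fun i j => a.coeff i * b.coeff j), Finset.sum_range_succ]
    obtain ⟨n, rfl⟩ := Nat.exists_eq_succ_of_ne_zero hn.ne'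
    rw [Finset.sum_range_succ', Finset.sum_eq_zero]
    · simp
    · intro i hi
      rw [(hlow (i + 1) (by lia) (by simp at hi; lia)).1, zero_mul]
  have van : ∀ r, 0 < r → r < e → a.coeff r = 0 ∧ b.coeff r = 0 := by
    intro r
    induction r using Nat.strong_induction_on with
    | _ r ih =>
      intro hr hre
      have h1 := key r hr fun i hi hir => ih i hir hi (hir.trans hre)
      rw [h r hr hre] at h1
      constructor
      · refine ha r hr (hab.dvd_of_dvd_mul_right (z := b.coeff 0) ⟨-b.coeff r, ?_⟩)
        linear_combination -h1
      · refine hb r hr (hab.symm.dvd_of_dvd_mul_left (y := a.coeff 0) ⟨-a.coeff r, ?_⟩)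
        linear_combination -h1
  exact ⟨van, fun he => key e he van⟩

lemma coeff_reverse_gradingHom_eq_zero {σ K : Type*} [Field K] (p : MvPolynomial σ K)
    (r : ℕ) (hr : 0 < r)
    (h : (gradingHom p).reverse.coeff 0 ∣ (gradingHom p).reverse.coeff r) :
    (gradingHom p).reverse.coeff r = 0 := by
  by_contra hne
  have h0 : (gradingHom p).reverse.coeff 0 ≠ 0 := fun h0 => hne (by rwa [h0, zero_dvd_iff] at h)
  obtain hlt | hle := lt_or_ge (gradingHom p).natDegree r
  · exact hne (Polynomial.coeff_eq_zero_of_natDegree_lt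
      ((Polynomial.reverse_natDegree_le _).trans_lt hlt))
  have hdeg := totalDegree_le_of_dvd_of_isDomain h hne
  have hr' : (gradingHom p).reverse.coeff r =
      (gradingHom p).coeff ((gradingHom p).natDegree - r) := by
    rw [Polynomial.coeff_reverse, Polynomial.revAt_le hle]
  rw [Polynomial.coeff_zero_reverse, Polynomial.leadingCoeff] at hdeg h0
  rw [hr'] at hdeg hne
  rw [(gradingHom_coeff_isHomogeneous p _).totalDegree hne,
    (gradingHom_coeff_isHomogeneous p _).totalDegree h0] at hdeg
  lia

section Numerators

variable {K : Type} [Field K]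

lemma delta3_ne_zero : delta3 K ≠ 0 := by
  have h : ∀ i j : Fin 3, i ≠ j → (X i + X j : MvPolynomial (Fin 3) K) ≠ 0 := fun i j hij h0 => by
    simpa [hij, hij.symm] using congrArg (eval (Pi.single i (1 : K))) h0
  exact mul_ne_zero (mul_ne_zero (h 0 1 (by decide)) (h 0 2 (by decide))) (h 1 2 (by decide))

lemma gradingHom_delta3 : gradingHom (delta3 K) = Polynomial.C (delta3 K) * Polynomial.X ^ 3 := by
  simp only [delta3, gradingHom, map_mul, map_add, aeval_X]
  ring

lemma delta3_mul_coeff_gradingHom {f : Polynomial K} {φ : MvPolynomial (Fin 3) K}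
    (hφ : delta3 K * φ = phiNum f) (j : ℕ) :
    delta3 K * (gradingHom φ).coeff j = C (f.coeff (j + 3)) * phiJNum K (j + 3) := by
  have h := congrArg (fun p => (gradingHom p).coeff (j + 3)) hφ
  have hsub : ∀ l : MvPolynomial (Fin 3) K,
      gradingHom l = Polynomial.C l * Polynomial.X → (gradingHom (Polynomial.aeval l f)).coeff (j + 3)
        = C (f.coeff (j + 3)) * l ^ (j + 3) := fun l hl => by
    rw [← Polynomial.aeval_algHom_apply, hl, coeff_aeval_C_mul_X, algebraMap_eq]
  simp only [map_mul, gradingHom_delta3] at h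
  rw [mul_right_comm, mul_comm _ (Polynomial.X ^ 3), Polynomial.coeff_X_pow_mul,
    Polynomial.coeff_C_mul] at h
  rw [h, phiNum, phiJNum]
  simp only [map_add, Polynomial.coeff_add]
  rw [hsub, hsub, hsub, hsub]
  · ring
  · simp only [gradingHom, map_add, aeval_X]
    ring
  all_goals simp [gradingHom]

lemma pderiv_phiJNum (i : Fin 3) (j : ℕ) : pderiv i (phiJNum K j) =
    (j : MvPolynomial (Fin 3) K) * (X i ^ (j - 1) + (X 0 + X 1 + X 2) ^ (j - 1)) := by
  fin_cases i <;> simp [phiJNum, pderiv_X] <;> ring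

variable [CharP K 2]

lemma natCast_eq_one_of_odd {A : Type*} [CommRing A] [CharP A 2] {j : ℕ} (hj : Odd j) :
    (j : A) = 1 := by
  obtain ⟨m, rfl⟩ := hj
  push_cast
  linear_combination (m : A) * CharTwo.two_eq_zero (R := A)

/-- Restriction to the line `x = y = u + 1`, `z = 1`. -/
noncomputable def diagHom (K : Type) [Field K] : MvPolynomial (Fin 3) K →ₐ[K] Polynomial K :=
  aeval ![Polynomial.X + 1, Polynomial.X + 1, 1]

omit [CharP K 2] in
lemma natDegree_diagHom_le (p : MvPolynomial (Fin 3) K) :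
    (diagHom K p).natDegree ≤ p.totalDegree := by
  refine natDegree_aeval_le_totalDegree _ (fun i => ?_) p
  have h : (Polynomial.X + 1 : Polynomial K).natDegree ≤ 1 := by
    simpa using (Polynomial.natDegree_X_add_C (1 : K)).le
  fin_cases i <;> simp [h]

lemma X_sq_mul_diagHom {φ : MvPolynomial (Fin 3) K} {j : ℕ} (hj : Odd j)
    (hφ : delta3 K * φ = phiJNum K j) :
    Polynomial.X ^ 2 * diagHom K φ = (Polynomial.X + 1) ^ (j - 1) + 1 := by
  have h := congrArg (fun p => diagHom K (pderiv 1 p)) hφ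
  have h2 : (2 : Polynomial K) = 0 := CharTwo.two_eq_zero
  have h3 : (Polynomial.X + 1 + (Polynomial.X + 1) + 1 : Polynomial K) = 1 := by
    linear_combination (Polynomial.X + 1) * h2
  have hx : pderiv 1 (delta3 K) = (X 0 + X 2) * (X 1 + X 2) + (X 0 + X 1) * (X 0 + X 2) := by
    simp [delta3, pderiv_X]
    ring
  simp only [pderiv_phiJNum, natCast_eq_one_of_odd hj, Derivation.leibniz, hx] at h
  simp only [delta3] at h
  simp [diagHom, h3] at h
  rw [← h, diagHom]
  generalize aeval ![Polynomial.X + 1, Polynomial.X + 1, (1 : Polynomial K)] φ = a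
  generalize aeval ![Polynomial.X + 1, Polynomial.X + 1, (1 : Polynomial K)] (pderiv 1 φ) = b
  linear_combination (-((Polynomial.X + 1) * (Polynomial.X + 2) ^ 2 * b +
    a * ((Polynomial.X + 1) * (Polynomial.X + 2) + 2 * Polynomial.X + 2))) * h2

lemma squarefree_gold {k : ℕ} (hk : k ≠ 0) {φ : MvPolynomial (Fin 3) K}
    (hφ : delta3 K * φ = phiJNum K (2 ^ k + 1)) : Squarefree φ := by
  intro c hc
  have hodd : Odd (2 ^ k + 1) := ((Nat.even_pow.2 ⟨even_two, hk⟩)).add_one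
  have hdvd : ∀ i, c ∣ X i ^ 2 ^ k + (X 0 + X 1 + X 2) ^ 2 ^ k := fun i => by
    have h := pderiv_phiJNum (K := K) i (2 ^ k + 1)
    obtain ⟨w, hw⟩ := hc
    rw [natCast_eq_one_of_odd hodd, one_mul, Nat.add_sub_cancel, ← hφ, hw] at h
    rw [← h, Derivation.leibniz, Derivation.leibniz, Derivation.leibniz]
    simp only [smul_eq_mul]
    exact ⟨delta3 K * (2 * w * pderiv i c + c * pderiv i w) + c * w * pderiv i (delta3 K), by ring⟩
  have h2 : (2 : MvPolynomial (Fin 3) K) = 0 := CharTwo.two_eq_zero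
  have e0 : (X 0 + (X 0 + X 1 + X 2) : MvPolynomial (Fin 3) K) = X 1 + X 2 := by
    linear_combination X 0 * h2
  have e1 : (X 1 + (X 0 + X 1 + X 2) : MvPolynomial (Fin 3) K) = X 0 + X 2 := by
    linear_combination X 1 * h2
  have h0 := hdvd 0
  have h1 := hdvd 1
  rw [← add_pow_char_pow, e0] at h0
  rw [← add_pow_char_pow, e1] at h1
  have hirr : Irreducible (X 1 + X 2 : MvPolynomial (Fin 3) K) := by
    simpa using irreducible_mul_X_add (1 : MvPolynomial (Fin 3) K) (X 2) 1 one_ne_zero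
      (by simp) (by simp) isRelPrime_one_left
  have hndvd : ¬ (X 1 + X 2 : MvPolynomial (Fin 3) K) ∣ X 0 + X 2 := fun h => by
    simpa using map_dvd (eval (Pi.single 0 (1 : K))) h
  exact (hirr.isRelPrime_iff_not_dvd.2 hndvd).pow_left.pow_right h0 h1

end Numerators

section Factorization

variable {K : Type} [Field K] [CharP K 2]

lemma diagHom_gold {k : ℕ} (hk : 2 ≤ 2 ^ k) {φ : MvPolynomial (Fin 3) K}
    (hφ : delta3 K * φ = phiJNum K (2 ^ k + 1)) :
    diagHom K φ = Polynomial.X ^ (2 ^ k - 2) := by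
  have hk0 : k ≠ 0 := by rintro rfl; simp at hk
  have h := X_sq_mul_diagHom (Nat.even_pow.2 ⟨even_two, hk0⟩).add_one hφ
  rw [Nat.add_sub_cancel, add_pow_char_pow, one_pow, add_assoc, CharTwo.add_self_eq_zero,
    add_zero] at h
  refine mul_left_cancel₀ (pow_ne_zero 2 Polynomial.X_ne_zero) (h.trans ?_)
  rw [← pow_add, Nat.add_sub_cancel' hk]

lemma le_two_pow_of_X_pow_dvd {i m t : ℕ} (hm : Odd m) {φ : MvPolynomial (Fin 3) K} (hi : i ≠ 0)
    (hφ : delta3 K * φ = phiJNum K (2 ^ i * m + 1))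
    (ht : Polynomial.X ^ t ∣ diagHom K φ) : t + 2 ≤ 2 ^ i := by
  have hodd : Odd (2 ^ i * m + 1) := ((Nat.even_pow.2 ⟨even_two, hi⟩).mul_right m).add_one
  have h := mul_dvd_mul_left (Polynomial.X ^ 2) ht
  rw [X_sq_mul_diagHom hodd hφ, ← pow_add, Polynomial.X_pow_dvd_iff] at h
  by_contra hlt
  have hpos : 2 ^ i ≠ 0 := by positivity
  have h1 := h (2 ^ i) (by lia)
  have hexp : (Polynomial.X + 1 : Polynomial K) ^ (2 ^ i * m) =
      Polynomial.expand K (2 ^ i) ((Polynomial.X + 1) ^ m) := by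
    rw [pow_mul, add_pow_char_pow, one_pow]
    simp
  rw [Nat.add_sub_cancel, hexp, Polynomial.coeff_add, Polynomial.coeff_one, if_neg hpos, add_zero,
    Polynomial.coeff_expand (by positivity), if_pos dvd_rfl, Nat.div_self (by positivity),
    Polynomial.coeff_X_add_one_pow, Nat.choose_one_right, natCast_eq_one_of_odd hm] at h1
  exact one_ne_zero h1

omit [CharP K 2] in
/-- If `p, q` are homogeneous of degree `s, t` and the product restricts to `u ^ (s + t)` on the
diagonal line, then `p` restricts to a multiple of `u ^ s`. -/
lemma diagHom_dvd_of_mul_eq {p q : MvPolynomial (Fin 3) K} {s t : ℕ} (hp : p.IsHomogeneous s)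
    (hq : q.IsHomogeneous t) (h : diagHom K (p * q) = Polynomial.X ^ (s + t)) :
    Polynomial.X ^ s ∣ diagHom K p := by
  have hp' := (natDegree_diagHom_le p).trans hp.totalDegree_le
  have hq' := (natDegree_diagHom_le q).trans hq.totalDegree_le
  have hdvd : diagHom K p ∣ Polynomial.X ^ (s + t) := ⟨_, by rw [← h, map_mul]⟩
  have hne : diagHom K p * diagHom K q ≠ 0 := by
    rw [← map_mul, h]
    exact pow_ne_zero _ Polynomial.X_ne_zero
  have hdeg := congrArg Polynomial.natDegree h
  rw [map_mul, Polynomial.natDegree_mul (left_ne_zero_of_mul hne) (right_ne_zero_of_mul hne),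
    Polynomial.natDegree_X_pow] at hdeg
  obtain ⟨i, -, hi⟩ := (dvd_prime_pow Polynomial.prime_X _).1 hdvd
  have hpi := Polynomial.natDegree_eq_of_degree_eq (Polynomial.degree_eq_degree_of_associated hi)
  rw [Polynomial.natDegree_X_pow] at hpi
  obtain rfl : i = s := by lia
  exact hi.symm.dvd

lemma natDegree_gradingHom_eq {f : Polynomial K} {k : ℕ} (hk : 2 ≤ 2 ^ k)
    (hf : f.coeff (2 ^ k + 1) = 1) (hf' : f.natDegree ≤ 2 ^ k + 1)
    {φG φ : MvPolynomial (Fin 3) K} (hφG : delta3 K * φG = phiJNum K (2 ^ k + 1))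
    (hφ : delta3 K * φ = phiNum f) :
    (gradingHom φ).coeff (2 ^ k - 2) = φG ∧ (gradingHom φ).natDegree = 2 ^ k - 2 := by
  have hcoeff : (gradingHom φ).coeff (2 ^ k - 2) = φG := by
    refine mul_left_cancel₀ delta3_ne_zero ?_
    rw [delta3_mul_coeff_gradingHom hφ, show 2 ^ k - 2 + 3 = 2 ^ k + 1 by lia, hf, hφG]
    simp
  refine ⟨hcoeff, Polynomial.natDegree_eq_of_le_of_coeff_ne_zero ?_ ?_⟩
  · refine Polynomial.natDegree_le_iff_coeff_eq_zero.2 fun j hj => ?_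
    refine (mul_eq_zero.1 ?_).resolve_left delta3_ne_zero
    rw [delta3_mul_coeff_gradingHom hφ, Polynomial.coeff_eq_zero_of_natDegree_lt (by lia)]
    simp
  · rw [hcoeff]
    rintro rfl
    have h := diagHom_gold hk hφG
    rw [map_zero] at h
    exact pow_ne_zero _ Polynomial.X_ne_zero h.symm

lemma isUnit_of_mul_eq_of_natDegree_le {k d : ℕ} (hd5 : 5 ≤ d) (hdlt : d < 2 ^ k + 1)
    (hdmod : d % 4 = 1) {h : Polynomial K} (hd : h.natDegree = d)
    {φG φd φ p q : MvPolynomial (Fin 3) K}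
    (hφG : delta3 K * φG = phiJNum K (2 ^ k + 1)) (hφd : delta3 K * φd = phiJNum K d)
    (hrp : IsRelPrime φG φd) (hφ : delta3 K * φ = phiNum (Polynomial.X ^ (2 ^ k + 1) + h))
    (hpq : φ = p * q) (hdeg : (gradingHom q).natDegree ≤ (gradingHom p).natDegree) :
    IsUnit q := by
  have hk0 : k ≠ 0 := by rintro rfl; simp at hdlt; lia
  set f : Polynomial K := Polynomial.X ^ (2 ^ k + 1) + h with hf
  have hfcoeff : ∀ j, f.coeff j = if j = 2 ^ k + 1 then 1 else h.coeff j := fun j => by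
    rw [hf, Polynomial.coeff_add, Polynomial.coeff_X_pow]
    split_ifs with hj
    · rw [Polynomial.coeff_eq_zero_of_natDegree_lt (by lia), add_zero]
    · rw [zero_add]
  have hfdeg : f.natDegree ≤ 2 ^ k + 1 :=
    Polynomial.natDegree_add_le_of_degree_le (Polynomial.natDegree_X_pow _).le (by lia)
  obtain ⟨hlead, hM⟩ := natDegree_gradingHom_eq (by lia) (by simp [hfcoeff]) hfdeg hφG hφ
  have hGne : φG ≠ 0 := by
    rintro rfl
    have := diagHom_gold (by lia) hφG
    rw [map_zero] at this
    exact pow_ne_zero _ Polynomial.X_ne_zero this.symm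
  set a := (gradingHom p).reverse with ha
  set b := (gradingHom q).reverse with hb
  set s := (gradingHom p).natDegree with hs
  set t := (gradingHom q).natDegree with ht
  have hab : (gradingHom φ).reverse = a * b := by
    rw [hpq, map_mul, Polynomial.reverse_mul_of_domain]
  have hne : gradingHom p * gradingHom q ≠ 0 := by
    rw [← map_mul, ← hpq]
    intro h0
    exact hGne (by rw [← hlead, h0, Polynomial.coeff_zero])
  have hst : s + t = 2 ^ k - 2 := by
    rw [← hM, hpq, map_mul,
      Polynomial.natDegree_mul (left_ne_zero_of_mul hne) (right_ne_zero_of_mul hne)]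
  have hcoeff : ∀ r, r ≤ 2 ^ k - 2 → delta3 K * (a * b).coeff r =
      C (f.coeff (2 ^ k + 1 - r)) * phiJNum K (2 ^ k + 1 - r) := fun r hr => by
    rw [← hab, Polynomial.coeff_reverse, hM, Polynomial.revAt_le hr,
      delta3_mul_coeff_gradingHom hφ, show 2 ^ k - 2 - r + 3 = 2 ^ k + 1 - r by lia]
  have hprod : a.coeff 0 * b.coeff 0 = φG := by
    rw [← Polynomial.mul_coeff_zero, ← hab, Polynomial.coeff_zero_reverse, Polynomial.leadingCoeff,
      hM, hlead]
  have ha0 : (a.coeff 0).IsHomogeneous s := by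
    rw [ha, Polynomial.coeff_zero_reverse]
    exact gradingHom_coeff_isHomogeneous p _
  have hb0 : (b.coeff 0).IsHomogeneous t := by
    rw [hb, Polynomial.coeff_zero_reverse]
    exact gradingHom_coeff_isHomogeneous q _
  have hcop : IsRelPrime (a.coeff 0) (b.coeff 0) :=
    IsRelPrime.of_squarefree_mul (hprod ▸ squarefree_gold hk0 hφG)
  obtain ⟨hlow, hmid⟩ := Polynomial.coeff_eq_zero_of_mul_coeff_eq_zero
    (e := 2 ^ k + 1 - d) hcop (coeff_reverse_gradingHom_eq_zero p)
    (coeff_reverse_gradingHom_eq_zero q) fun r hr hre => by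
      refine (mul_eq_zero.1 ?_).resolve_left delta3_ne_zero
      rw [hcoeff r (by lia), hfcoeff, if_neg (by lia),
        Polynomial.coeff_eq_zero_of_natDegree_lt (by lia)]
      simp
  have hlc : h.coeff d ≠ 0 := by
    rw [← hd]
    exact Polynomial.leadingCoeff_ne_zero.2 (by rintro rfl; simp at hd; lia)
  have hmid : C (h.coeff d) * φd = a.coeff 0 * b.coeff (2 ^ k + 1 - d) +
      a.coeff (2 ^ k + 1 - d) * b.coeff 0 := by
    rw [← hmid (by lia)]
    refine mul_left_cancel₀ delta3_ne_zero ?_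
    rw [hcoeff _ (by lia), show 2 ^ k + 1 - (2 ^ k + 1 - d) = d by lia, hfcoeff, if_neg (by lia),
      ← hφd]
    ring
  have hunit : IsUnit (C (h.coeff d) : MvPolynomial (Fin 3) K) :=
    (isUnit_iff_ne_zero.2 hlc).map C
  have hdiag : diagHom K (a.coeff 0 * b.coeff 0) = Polynomial.X ^ (s + t) := by
    rw [hprod, hst, diagHom_gold (by lia) hφG]
  have hXt : Polynomial.X ^ t ∣ diagHom K φd := by
    have hXa := (pow_dvd_pow _ hdeg).trans (diagHom_dvd_of_mul_eq ha0 hb0 hdiag)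
    have hXb := diagHom_dvd_of_mul_eq hb0 ha0 (by rw [mul_comm, hdiag, add_comm])
    have := dvd_add (hXa.mul_right (diagHom K (b.coeff (2 ^ k + 1 - d))))
      (hXb.mul_left (diagHom K (a.coeff (2 ^ k + 1 - d))))
    rw [← map_mul, ← map_mul, ← map_add, ← hmid, map_mul] at this
    exact ((hunit.map (diagHom K)).dvd_mul_left).1 this
  obtain ⟨i, m, hm, him⟩ := Nat.exists_eq_two_pow_mul_odd (n := d - 1) (by lia)
  have hti : t < 2 ^ k + 1 - d := by
    obtain rfl : d = 2 ^ i * m + 1 := by lia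
    have hi : i ≠ 0 := by
      rintro rfl
      obtain ⟨w, rfl⟩ := hm
      lia
    have h2 := le_two_pow_of_X_pow_dvd hm hi hφd hXt
    have hik : i ≤ k := by
      refine (Nat.pow_le_pow_iff_right (le_refl 2)).1 ?_
      have : 2 ^ i * 1 ≤ 2 ^ i * m := Nat.mul_le_mul_left _ hm.pos
      lia
    have hdvd : 2 ^ i ∣ 2 ^ k - 2 ^ i * m := Nat.dvd_sub (pow_dvd_pow 2 hik) (dvd_mul_right _ _)
    have := Nat.le_of_dvd (by lia) hdvd
    lia
  have hbe : b.coeff (2 ^ k + 1 - d) = 0 := Polynomial.coeff_eq_zero_of_natDegree_lt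
    ((Polynomial.reverse_natDegree_le _).trans_lt hti)
  rw [hbe, mul_zero, zero_add] at hmid
  have hb0unit : IsUnit (b.coeff 0) := by
    refine hrp ⟨a.coeff 0, by rw [← hprod, mul_comm]⟩ ?_
    rw [← hunit.dvd_mul_left, hmid]
    exact dvd_mul_left _ _
  have ht0 : t = 0 := by
    rw [← hb0.totalDegree hb0unit.ne_zero, (isUnit_iff_totalDegree_of_isReduced.1 hb0unit).2]
  rw [hb, Polynomial.coeff_zero_reverse, Polynomial.leadingCoeff, ← ht, ht0] at hb0unit
  rwa [← eval_one_gradingHom q, Polynomial.eq_C_of_natDegree_eq_zero ht0, Polynomial.eval_C]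

theorem irreducible_of_gold_add {k d : ℕ} (hd5 : 5 ≤ d) (hdlt : d < 2 ^ k + 1)
    (hdmod : d % 4 = 1) {h : Polynomial K} (hd : h.natDegree = d)
    {φG φd φ : MvPolynomial (Fin 3) K}
    (hφG : delta3 K * φG = phiJNum K (2 ^ k + 1)) (hφd : delta3 K * φd = phiJNum K d)
    (hrp : IsRelPrime φG φd) (hφ : delta3 K * φ = phiNum (Polynomial.X ^ (2 ^ k + 1) + h)) :
    Irreducible φ where
  not_isUnit hu := by
    have hcoeff : (Polynomial.X ^ (2 ^ k + 1) + h).coeff (2 ^ k + 1) = 1 := by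
      rw [Polynomial.coeff_add, Polynomial.coeff_X_pow_self,
        Polynomial.coeff_eq_zero_of_natDegree_lt (by lia), add_zero]
    have hdeg := (natDegree_gradingHom_eq (by lia) hcoeff
      (Polynomial.natDegree_add_le_of_degree_le (Polynomial.natDegree_X_pow _).le (by lia))
      hφG hφ).2
    rw [Polynomial.natDegree_eq_zero_of_isUnit (hu.map gradingHom)] at hdeg
    lia
  isUnit_or_isUnit p q hpq := by
    rcases le_total (gradingHom q).natDegree (gradingHom p).natDegree with hle | hle
    · exact Or.inr (isUnit_of_mul_eq_of_natDegree_le hd5 hdlt hdmod hd hφG hφd hrp hφ hpq hle)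
    · exact Or.inl (isUnit_of_mul_eq_of_natDegree_le hd5 hdlt hdmod hd hφG hφd hrp hφ
        (hpq.trans (mul_comm p q)) hle)

end Factorization

section Map

variable {L M : Type} [CommRing L] [CommRing M] (g : L →+* M)

lemma map_delta3 : map g (delta3 L) = delta3 M := by
  simp [delta3]

lemma map_phiJNum (j : ℕ) : map g (phiJNum L j) = phiJNum M j := by
  simp [phiJNum]

lemma map_phiNum (f : Polynomial L) : map g (phiNum f) = phiNum (f.map g) := by
  have hsub : ∀ l : MvPolynomial (Fin 3) L,
      map g (Polynomial.aeval l f) = Polynomial.aeval (map g l) (f.map g) := fun l => by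
    rw [Polynomial.aeval_def, Polynomial.aeval_def, Polynomial.hom_eval₂, Polynomial.eval₂_map]
    congr 1
    ext
    simp [algebraMap_eq]
  simp [phiNum, hsub]

end Map

/-- Let `L = F_q`, `q = 2^n`, `k ≥ 2`, and `f(x) = x^{2^k+1} + h(x)`
with `deg h = d`, `d ≡ 1 (mod 4)`, `5 ≤ d < 2^k + 1`. If `φ_{2^k+1}` and `φ_d`
are relatively prime over the algebraic closure of `L`, then `φ` is absolutely
irreducible. -/
theorem gold_plus_deg_one_mod_four_abs_irred {n : ℕ} (hn : 0 < n) (L : Type)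
    [Field L] [Fintype L] (hcard : Fintype.card L = 2 ^ n)
    (k : ℕ) (hk : 2 ≤ k) (h : Polynomial L) (d : ℕ) (hd : h.natDegree = d)
    (hd5 : 5 ≤ d) (hdlt : d < 2 ^ k + 1) (hdmod : d % 4 = 1)
    (f : Polynomial L) (hf : f = Polynomial.X ^ (2 ^ k + 1) + h)
    (φG : MvPolynomial (Fin 3) L) (hφG : delta3 L * φG = phiJNum L (2 ^ k + 1))
    (φd : MvPolynomial (Fin 3) L) (hφd : delta3 L * φd = phiJNum L d)
    (hrp : IsRelPrime (MvPolynomial.map (algebraMap L (AlgebraicClosure L)) φG)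
      (MvPolynomial.map (algebraMap L (AlgebraicClosure L)) φd))
    (φ : MvPolynomial (Fin 3) L) (hφ : delta3 L * φ = phiNum f) :
    AbsolutelyIrreducible φ := by
  subst hf
  have : CharP L 2 := charP_of_card_eq_prime_pow hcard
  set K := AlgebraicClosure L
  have : CharP K 2 := charP_of_injective_algebraMap (algebraMap L K).injective 2
  have hG := congrArg (map (algebraMap L K)) hφG
  have hD := congrArg (map (algebraMap L K)) hφd
  have hF := congrArg (map (algebraMap L K)) hφ
  simp only [map_mul, map_delta3, map_phiJNum, map_phiNum, Polynomial.map_add, Polynomial.map_pow,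
    Polynomial.map_X] at hG hD hF
  exact irreducible_of_gold_add hd5 hdlt hdmod (by rw [Polynomial.natDegree_map, hd]) hG hD hrp hF
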